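/- arXiv:2504.09239 — 2 statements merged into one kernel-verified Lean document; each statement's English description precedes it below -/
import Mathlib

section
/- Let A be a finite rank-1 ℤ_p[G]-module with p^r = |(g−1)A| and p^s = |A^G|, where r ≥ 1 and s ≥ 1, and let e ∈ L be a norm-lift. Then there exists a unique t ∈ {0, 1, …, p−1} such that for EVERY generator a of A (i.e. every a ∈ A with L·a = A) one has p^s·a = e^s·(g−1)^(s(p−1))·a + t·(g−1)^r·a. -/
noncomputable section

/-- The group algebra `ℤ_p[G]` for `G` cyclic of order `p`. -/
abbrev L (p : ℕ) [Fact p.Prime] : Type := MonoidAlgebra (PadicInt p) (Multiplicative (ZMod p))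

/-- The fixed generator `g` of `G`, viewed inside `L = ℤ_p[G]`. -/
def gL (p : ℕ) [Fact p.Prime] : L p :=
  MonoidAlgebra.of (PadicInt p) (Multiplicative (ZMod p)) (Multiplicative.ofAdd 1)

/-- The norm element `N = 1 + g + ⋯ + g^(p-1)` of `L`. -/
def NL (p : ℕ) [Fact p.Prime] : L p := ∑ i ∈ Finset.range p, gL p ^ i


/-- `e ∈ L` is a norm-lift if `p·1 = e·(g−1)^(p−1) + α·N` for some `α ∈ ℤ_p`. -/
def IsNormLift (p : ℕ) [Fact p.Prime] (e : L p) : Prop :=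
  ∃ α : PadicInt p, (p : L p) = e * (gL p - 1) ^ (p - 1) + α • NL p

/-- The submodule `(g−1)A` of an `ℤ_p[G]`-module `A`. -/
def commSub (p : ℕ) [Fact p.Prime] (A : Type) [AddCommGroup A] [Module (L p) A] :
    Submodule (L p) A :=
  LinearMap.range (LinearMap.lsmul (L p) A (gL p - 1))

/-- The fixed-point submodule `A^G = {x ∈ A : g·x = x}` of an `ℤ_p[G]`-module `A`. -/
def fixedSub (p : ℕ) [Fact p.Prime] (A : Type) [AddCommGroup A] [Module (L p) A] :
    Submodule (L p) A :=
  LinearMap.ker (LinearMap.lsmul (L p) A (gL p - 1))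

/-- An `ℤ_p[G]`-module has rank 1 if it is nonzero and generated by a single element. -/
def IsRankOne (p : ℕ) [Fact p.Prime] (A : Type) [AddCommGroup A] [Module (L p) A] : Prop :=
  Nontrivial A ∧ ∃ a : A, Submodule.span (L p) {a} = ⊤

section aux

variable {R : Type} [CommRing R] {A : Type} [AddCommGroup A] [Module R A]

def SS (A : Type) [AddCommGroup A] [Module R A] (x : R) (k : ℕ) : Submodule R A :=
  LinearMap.range (LinearMap.lsmul R A (x ^ k))

lemma mem_SS (x : R) (k : ℕ) (z : A) : z ∈ SS A x k ↔ ∃ b : A, x ^ k • b = z := by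
  simp [SS]

lemma SS_anti (x : R) {k l : ℕ} (h : k ≤ l) {z : A} (hz : z ∈ SS A x l) : z ∈ SS A x k := by
  rw [mem_SS] at *
  obtain ⟨b, rfl⟩ := hz
  obtain ⟨d, rfl⟩ := Nat.exists_eq_add_of_le h
  exact ⟨x ^ d • b, by rw [smul_smul, pow_add]⟩

lemma SS_p (p : ℕ) (hp : p.Prime) (x e : R) (h1 : (p : R) * x = e * x ^ p) (k : ℕ) (hk : 1 ≤ k)
    {z : A} (hz : z ∈ SS A x k) : (p : R) • z ∈ SS A x (k + 1) := by
  rw [mem_SS] at *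
  obtain ⟨b, rfl⟩ := hz
  obtain ⟨d, rfl⟩ := Nat.exists_eq_add_of_le hk
  obtain ⟨q, hq⟩ := Nat.exists_eq_add_of_le hp.two_le
  refine ⟨(e * x ^ q) • b, ?_⟩
  rw [smul_smul, smul_smul]
  congr 1
  have : (p : R) * x ^ (1 + d) = (p * x) * x ^ d := by ring
  rw [this, h1, hq]
  ring

/-- decomposition -/
lemma SS_dec (p : ℕ) (hp : p.Prime) (x e : R) (h1 : (p : R) * x = e * x ^ p)
    (hdec : ∀ u : R, ∃ c : ℕ, c < p ∧ ∃ v w : R, u = c + p * v + x * w)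
    (a : A) (ha : ∀ b : A, ∃ u : R, u • a = b) (k : ℕ) (hk : 1 ≤ k) {z : A}
    (hz : z ∈ SS A x k) :
    ∃ c : ℕ, c < p ∧ z - (c : R) • x ^ k • a ∈ SS A x (k + 1) := by
  obtain ⟨b, rfl⟩ := (mem_SS _ _ _).1 hz
  obtain ⟨u, rfl⟩ := ha b
  obtain ⟨c, hc, v, w, rfl⟩ := hdec u
  refine ⟨c, hc, ?_⟩
  have : x ^ k • ((c : R) + p * v + x * w) • a - (c : R) • x ^ k • a
      = (p : R) • (x ^ k • (v • a)) + x ^ (k + 1) • (w • a) := by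
    simp only [smul_smul, ← sub_smul, ← add_smul]
    congr 1; ring
  rw [this]
  exact add_mem (SS_p p hp x e h1 k hk ((mem_SS _ _ _).2 ⟨_, rfl⟩)) ((mem_SS _ _ _).2 ⟨_, rfl⟩)

lemma SS_key (p : ℕ) (hp : p.Prime) (x e : R) (h1 : (p : R) * x = e * x ^ p)
    (a : A) (ha : ∀ b : A, ∃ u : R, u • a = b)
    (n : ℕ) (hn : x ^ (n + 1) • a = 0) (hn' : x ^ n • a ≠ 0)
    (k : ℕ) (hk : 1 ≤ k) (hkn : k ≤ n) (c : ℤ) (hc : (c : R) • x ^ k • a ∈ SS A x (k + 1)) :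
    (p : ℤ) ∣ c := by
  by_contra hcd
  have hcop : IsCoprime (p : ℤ) c :=
    (Prime.coprime_iff_not_dvd (Nat.prime_iff_prime_int.1 hp)).2 hcd
  obtain ⟨i, j, hij⟩ := hcop
  have hx : x ^ k • a ∈ SS A x (k + 1) := by
    have e1 : x ^ k • a = (i : R) • (p : R) • x ^ k • a + (j : R) • (c : R) • x ^ k • a := by
      rw [smul_smul (i : R), smul_smul (j : R), ← add_smul]
      have : (i : R) * p + j * c = 1 := by exact_mod_cast congrArg (Int.cast : ℤ → R) hij
      rw [this, one_smul]
    rw [e1]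
    exact add_mem (Submodule.smul_mem _ _
      (SS_p p hp x e h1 k hk ((mem_SS _ _ _).2 ⟨_, rfl⟩))) (Submodule.smul_mem _ _ hc)
  obtain ⟨b, hb⟩ := (mem_SS _ _ _).1 hx
  obtain ⟨u, rfl⟩ := ha b
  obtain ⟨d, rfl⟩ := Nat.exists_eq_add_of_le hkn
  apply hn'
  calc x ^ (k + d) • a = x ^ d • (x ^ k • a) := by rw [smul_smul]; congr 1; ring
    _ = u • (x ^ (k + d + 1) • a) := by
        rw [← hb]; simp only [smul_smul]; congr 1; ring
    _ = 0 := by rw [hn, smul_zero]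

lemma SS_card (p : ℕ) (hp : p.Prime) (x e : R) (h1 : (p : R) * x = e * x ^ p)
    (hdec : ∀ u : R, ∃ c : ℕ, c < p ∧ ∃ v w : R, u = c + p * v + x * w)
    (a : A) (ha : ∀ b : A, ∃ u : R, u • a = b)
    (n : ℕ) (hn : x ^ (n + 1) • a = 0) (hn' : x ^ n • a ≠ 0)
    (k : ℕ) (hk : 1 ≤ k) (hkn : k ≤ n) :
    Nat.card (SS A x k) = p * Nat.card (SS A x (k + 1)) := by
  let f : Fin p × SS A x (k + 1) → SS A x k := fun q =>
    ⟨((q.1 : ℕ) : R) • x ^ k • a + q.2.1, add_mem (Submodule.smul_mem _ _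
      ((mem_SS _ _ _).2 ⟨_, rfl⟩)) (SS_anti x (Nat.le_succ k) q.2.2)⟩
  have hf : Function.Bijective f := by
    constructor
    · rintro ⟨t, y⟩ ⟨t', y'⟩ h
      have h2 : ((t : ℕ) : R) • x ^ k • a + y.1 = ((t' : ℕ) : R) • x ^ k • a + y'.1 :=
        congrArg Subtype.val h
      have h3 : (p : ℤ) ∣ ((t : ℕ) : ℤ) - ((t' : ℕ) : ℤ) := by
        apply SS_key p hp x e h1 a ha n hn hn' k hk hkn
        have : (((((t : ℕ) : ℤ) - ((t' : ℕ) : ℤ) : ℤ)) : R) • x ^ k • a = y'.1 - y.1 := by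
          push_cast
          rw [sub_smul, sub_eq_sub_iff_add_eq_add, h2, add_comm]
        rw [this]
        exact sub_mem y'.2 y.2
      have h4 : t = t' := by
        have := Int.eq_zero_of_abs_lt_dvd h3 (by rw [abs_lt]; omega)
        ext; omega
      subst h4
      have : y = y' := Subtype.ext (add_left_cancel h2)
      rw [this]
    · rintro ⟨z, hz⟩
      obtain ⟨c, hc, hcz⟩ := SS_dec p hp x e h1 hdec a ha k hk hz
      exact ⟨(⟨c, hc⟩, ⟨_, hcz⟩), Subtype.ext (by simp [f])⟩
  rw [← Nat.card_congr (Equiv.ofBijective f hf), Nat.card_prod, Nat.card_fin]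

lemma SS_card_pow (p : ℕ) (hp : p.Prime) (x e : R) (h1 : (p : R) * x = e * x ^ p)
    (hdec : ∀ u : R, ∃ c : ℕ, c < p ∧ ∃ v w : R, u = c + p * v + x * w)
    (a : A) (ha : ∀ b : A, ∃ u : R, u • a = b)
    (n : ℕ) (hn : x ^ (n + 1) • a = 0) (hn' : x ^ n • a ≠ 0)
    (j : ℕ) (hj : j ≤ n) :
    Nat.card (SS A x (n + 1 - j)) = p ^ j := by
  induction j with
  | zero =>
    have : SS A x (n + 1) = ⊥ := by
      rw [eq_bot_iff]
      intro z hz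
      obtain ⟨b, rfl⟩ := (mem_SS _ _ _).1 hz
      obtain ⟨u, rfl⟩ := ha b
      rw [smul_comm, hn, smul_zero]; exact zero_mem _
    simp [this]
  | succ j ih =>
    rw [SS_card p hp x e h1 hdec a ha n hn hn' (n + 1 - (j + 1)) (by omega) (by omega)]
    have : n + 1 - (j + 1) + 1 = n + 1 - j := by omega
    rw [this, ih (by omega), pow_succ, mul_comm]

lemma SS_ker (p : ℕ) (hp : p.Prime) (x e : R) (h1 : (p : R) * x = e * x ^ p)
    (hdec : ∀ u : R, ∃ c : ℕ, c < p ∧ ∃ v w : R, u = c + p * v + x * w)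
    (a : A) (ha : ∀ b : A, ∃ u : R, u • a = b)
    (n : ℕ) (hn : x ^ (n + 1) • a = 0) (hn' : x ^ n • a ≠ 0)
    (z : A) (hxz : x • z = 0) (hz1 : z ∈ SS A x 1)
    (k : ℕ) (hkn : k + 1 ≤ n) : z ∈ SS A x (k + 1) := by
  induction k with
  | zero => exact hz1
  | succ k ih =>
    obtain ⟨c, hc, hcz⟩ := SS_dec p hp x e h1 hdec a ha (k + 1) (by omega) (ih (by omega))
    have h3 : (p : ℤ) ∣ (c : ℤ) := by
      apply SS_key p hp x e h1 a ha n hn hn' (k + 1 + 1) (by omega) hkn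
      obtain ⟨b, hb⟩ := (mem_SS _ _ _).1 hcz
      refine (mem_SS _ _ _).2 ⟨-b, ?_⟩
      have h4 : x • (x ^ (k + 1 + 1) • b) = - (x • (c : R) • x ^ (k + 1) • a) := by
        rw [hb, smul_sub, hxz, zero_sub]
      rw [smul_neg, pow_succ' x (k + 1 + 1), ← smul_smul, h4, neg_neg]
      simp only [smul_smul, Int.cast_natCast]; congr 1; ring
    have h4 : c = 0 := Nat.eq_zero_of_dvd_of_lt (by exact_mod_cast h3) hc
    simpa [h4] using hcz

theorem main_aux (p : ℕ) (hp : p.Prime) (x e w : R) (h1 : (p : R) * x = e * x ^ p)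
    (h2 : x ^ p = p * w)
    (hdec : ∀ u : R, ∃ c : ℕ, c < p ∧ ∃ v w : R, u = c + p * v + x * w) [Finite A]
    (a : A) (ha : ∀ b : A, ∃ u : R, u • a = b) (r s : ℕ) (hr : 1 ≤ r) (hs : 1 ≤ s)
    (hcr : Nat.card (LinearMap.range (LinearMap.lsmul R A x)) = p ^ r)
    (hcs : Nat.card (LinearMap.ker (LinearMap.lsmul R A x)) = p ^ s) :
    (∃ t : ℕ, t < p ∧ (p : R) ^ s • a = (e ^ s * x ^ (s * (p - 1))) • a + ((t : R) * x ^ r) • a)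
    ∧ ∀ t t' : ℕ, t < p → t' < p → ((t : R) * x ^ r) • a = ((t' : R) * x ^ r) • a → t = t' := by
  have hS1 : SS A x 1 = LinearMap.range (LinearMap.lsmul R A x) := by rw [SS, pow_one]
  -- cardinality of A
  have hcA : Nat.card A = p ^ s * p ^ r := by
    rw [Submodule.card_eq_card_quotient_mul_card (LinearMap.ker (LinearMap.lsmul R A x)),
      Nat.card_congr (LinearMap.quotKerEquivRange (LinearMap.lsmul R A x)).toEquiv, hcr, hcs,
      mul_comm]
  have hcq : Nat.card (A ⧸ SS A x 1) = p ^ s := by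
    have := Submodule.card_eq_card_quotient_mul_card (SS A x 1)
    rw [hcA, hS1, hcr] at this
    rw [hS1]
    first
      | exact (Nat.eq_of_mul_eq_mul_right (pow_pos hp.pos r) this).symm
      | exact (Nat.eq_of_mul_eq_mul_left (pow_pos hp.pos r) (by rw [mul_comm, this])).symm
  have hnil : ∃ m, x ^ m • a = 0 := by
    refine ⟨p * (s + r), ?_⟩
    rw [pow_mul, h2, mul_pow, mul_comm, ← smul_smul, pow_add (p : R)]
    have : ((p : R) ^ s * (p : R) ^ r) • a = Nat.card A • a := by
      rw [hcA, ← Nat.cast_smul_eq_nsmul R]; push_cast; rfl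
    rw [this, card_nsmul_eq_zero', smul_zero]
  classical
  obtain ⟨n, hn, hn'⟩ : ∃ n, x ^ (n + 1) • a = 0 ∧ x ^ n • a ≠ 0 := by
    have hne : Nat.find hnil ≠ 0 := by
      intro h0
      have h := Nat.find_spec hnil
      rw [h0, pow_zero, one_smul] at h
      have : Subsingleton A := ⟨fun b c => by
        obtain ⟨u, rfl⟩ := ha b
        obtain ⟨v, rfl⟩ := ha c
        simp [h]⟩
      have h3 : Nat.card A = 1 := Nat.card_eq_one_iff_unique.2 ⟨this, ⟨a⟩⟩
      rw [hcA, ← pow_add] at h3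
      exact absurd h3 (Nat.one_lt_pow (by omega) hp.one_lt).ne'
    obtain ⟨n, hn⟩ := Nat.exists_eq_succ_of_ne_zero hne
    refine ⟨n, ?_, Nat.find_min hnil (by omega)⟩
    have := Nat.find_spec hnil
    rwa [hn] at this
  have hnr : n = r := by
    have := SS_card_pow p hp x e h1 hdec a ha n hn hn' n le_rfl
    rw [Nat.add_sub_cancel_left, hS1, hcr] at this
    exact (Nat.pow_right_injective hp.two_le this).symm
  subst hnr
  have hpx : (p : R) • x ^ n • a = 0 := by
    have := SS_p p hp x e h1 n hr (z := x ^ n • a) ((mem_SS _ _ _).2 ⟨_, rfl⟩)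
    obtain ⟨b, hb⟩ := (mem_SS _ _ _).1 this
    obtain ⟨u, rfl⟩ := ha b
    rw [← hb, smul_comm, hn, smul_zero]
  constructor
  · have hpow : ∀ m : ℕ, x * (p : R) ^ m = x * (e ^ m * x ^ (m * (p - 1))) := by
      intro m
      induction m with
      | zero => simp
      | succ m ih =>
        have hpp : x ^ p = x ^ (p - 1) * x := by
          rw [← pow_succ, Nat.sub_add_cancel hp.one_le]
        calc x * (p : R) ^ (m + 1) = p * (x * p ^ m) := by ring
          _ = (p * x) * (e ^ m * x ^ (m * (p - 1))) := by rw [ih]; ring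
          _ = _ := by rw [h1, hpp, Nat.succ_mul, pow_add]; ring
    set y := (p : R) ^ s • a - (e ^ s * x ^ (s * (p - 1))) • a with hy
    have hxy : x • y = 0 := by
      rw [hy, smul_sub, smul_smul, smul_smul, hpow, sub_self]
    have hy1 : y ∈ SS A x 1 := by
      apply sub_mem
      · rw [← Submodule.Quotient.mk_eq_zero, Submodule.Quotient.mk_smul]
        have : ((p : R) ^ s) • (Submodule.Quotient.mk a : A ⧸ SS A x 1)
            = Nat.card (A ⧸ SS A x 1) • (Submodule.Quotient.mk a : A ⧸ SS A x 1) := by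
          rw [hcq, ← Nat.cast_smul_eq_nsmul R]; push_cast; rfl
        rw [this, card_nsmul_eq_zero']
      · have : 1 ≤ s * (p - 1) := Nat.mul_pos hs (Nat.sub_pos_of_lt hp.one_lt)
        apply SS_anti x this
        exact (mem_SS _ _ _).2 ⟨e ^ s • a, by rw [smul_smul, mul_comm]⟩
    have hyn := SS_ker p hp x e h1 hdec a ha n hn hn' y hxy hy1 (n - 1) (by omega)
    rw [Nat.sub_add_cancel hr] at hyn
    obtain ⟨c, hc, hcz⟩ := SS_dec p hp x e h1 hdec a ha n hr hyn
    refine ⟨c, hc, ?_⟩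
    obtain ⟨b, hb⟩ := (mem_SS _ _ _).1 hcz
    obtain ⟨u, rfl⟩ := ha b
    rw [smul_comm, hn, smul_zero] at hb
    rw [← sub_eq_iff_eq_add', ← hy, ← smul_smul]
    exact sub_eq_zero.1 hb.symm
  · intro t t' ht ht' h
    have h3 : (p : ℤ) ∣ (t : ℤ) - (t' : ℤ) := by
      apply SS_key p hp x e h1 a ha n hn hn' n hr le_rfl
      have : ((((t : ℤ) - (t' : ℤ) : ℤ)) : R) • x ^ n • a = 0 := by
        push_cast
        rw [sub_smul, smul_smul, smul_smul, h, sub_self]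
      rw [this]; exact zero_mem _
    have := Int.eq_zero_of_abs_lt_dvd h3 (by rw [abs_lt]; omega)
    omega

end aux

lemma gL_pow_p (p : ℕ) [Fact p.Prime] : gL p ^ p = 1 := by
  rw [gL, ← map_pow, ← ofAdd_nsmul]
  simp [MonoidAlgebra.one_def]

lemma gL_dec (p : ℕ) [Fact p.Prime] (u : L p) :
    ∃ c : ℕ, c < p ∧ ∃ v w : L p, u = c + p * v + (gL p - 1) * w := by
  have hp : p.Prime := Fact.out
  suffices h : ∃ c : ℕ, ∃ v w : L p, u = c + p * v + (gL p - 1) * w by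
    obtain ⟨c, v, w, rfl⟩ := h
    refine ⟨c % p, Nat.mod_lt _ hp.pos, v + ((c / p : ℕ) : L p), w, ?_⟩
    have : (c : L p) = ((c % p + p * (c / p) : ℕ) : L p) := by rw [Nat.mod_add_div]
    rw [this]; push_cast; ring
  induction u using MonoidAlgebra.induction_on with
  | of g =>
    have hg : MonoidAlgebra.of (PadicInt p) (Multiplicative (ZMod p)) g
        = gL p ^ (Multiplicative.toAdd g).val := by
      rw [gL, ← map_pow, ← ofAdd_nsmul]
      congr 1
      apply Multiplicative.toAdd.injective
      simp
    obtain ⟨w, hw⟩ := sub_dvd_pow_sub_pow (gL p) 1 (Multiplicative.toAdd g).val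
    refine ⟨1, 0, w, ?_⟩
    rw [hg, ← hw]; simp
  | add f g hf hg =>
    obtain ⟨c, v, w, rfl⟩ := hf
    obtain ⟨c', v', w', rfl⟩ := hg
    exact ⟨c + c', v + v', w + w', by push_cast; ring⟩
  | smul r f hf =>
    obtain ⟨c, v, w, rfl⟩ := hf
    obtain ⟨d, hd⟩ : ∃ d : PadicInt p, r - (r.zmodRepr : PadicInt p) = p * d := by
      have := PadicInt.sub_zmodRepr_mem (x := r)
      rw [PadicInt.maximalIdeal_eq_span_p, Ideal.mem_span_singleton] at this
      exact this
    have hr : algebraMap (PadicInt p) (L p) r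
        = (r.zmodRepr : L p) + p * algebraMap (PadicInt p) (L p) d := by
      rw [sub_eq_iff_eq_add'] at hd
      conv_lhs => rw [hd]
      rw [map_add, map_mul, map_natCast, map_natCast]
    rw [Algebra.smul_def, hr]
    refine ⟨r.zmodRepr * c, (r.zmodRepr : L p) * v + algebraMap (PadicInt p) (L p) d * (c + p * v),
      (r.zmodRepr + p * algebraMap (PadicInt p) (L p) d) * w, ?_⟩
    push_cast; ring


/-- for a finite rank-1 `ℤ_p[G]`-module `A` with `|(g−1)A| = p^r`,
`|A^G| = p^s`, `r, s ≥ 1`, and a norm-lift `e`, there is a unique `t ∈ {0,…,p−1}`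
such that `p^s·a = e^s(g−1)^(s(p−1))·a + t(g−1)^r·a` for every generator `a` of `A`. -/
theorem stmt_3 (p : ℕ) [Fact p.Prime] (e : L p) (he : IsNormLift p e)
    (A : Type) [AddCommGroup A] [Module (L p) A] [Finite A]
    (hA : IsRankOne p A) (r s : ℕ) (hr : 1 ≤ r) (hs : 1 ≤ s)
    (hcard_r : Nat.card (commSub p A) = p ^ r)
    (hcard_s : Nat.card (fixedSub p A) = p ^ s) :
    ∃! t : Fin p, ∀ a : A, Submodule.span (L p) {a} = ⊤ →
      (p : L p) ^ s • a
        = (e ^ s * (gL p - 1) ^ (s * (p - 1))) • a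
          + (((t : ℕ) : L p) * (gL p - 1) ^ r) • a := by
  have hp : p.Prime := Fact.out
  obtain ⟨_, a, hspan⟩ := hA
  have ha : ∀ b : A, ∃ u : L p, u • a = b := fun b =>
    Submodule.mem_span_singleton.1 (hspan ▸ Submodule.mem_top)
  have h1 : (p : L p) * (gL p - 1) = e * (gL p - 1) ^ p := by
    obtain ⟨α, hα⟩ := he
    have hN : NL p * (gL p - 1) = 0 := by
      rw [NL, geom_sum_mul, gL_pow_p, sub_self]
    have hpp : (gL p - 1) ^ p = (gL p - 1) ^ (p - 1) * (gL p - 1) := by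
      rw [← pow_succ, Nat.sub_add_cancel hp.one_le]
    rw [hα, add_mul, smul_mul_assoc, hN, smul_zero, add_zero, hpp, mul_assoc]
  obtain ⟨w, h2⟩ : ∃ w : L p, (gL p - 1) ^ p = p * w := by
    obtain ⟨w, hw⟩ := exists_add_pow_prime_eq hp (gL p - 1) 1
    rw [sub_add_cancel, gL_pow_p, one_pow] at hw
    exact ⟨-((gL p - 1) * 1 * w), by linear_combination -hw⟩
  obtain ⟨⟨t, ht, hta⟩, huniq⟩ := main_aux p hp (gL p - 1) e w h1 h2 (gL_dec p) a ha r s hr hs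
    hcard_r hcard_s
  refine ⟨⟨t, ht⟩, ?_, ?_⟩
  · intro b _
    obtain ⟨u, rfl⟩ := ha b
    rw [smul_comm _ u a, hta, smul_add, smul_comm u, smul_comm u]
  · intro t' h'
    have h3 := h' a hspan
    rw [hta] at h3
    exact Fin.ext (huniq t t' ht t'.2 (add_left_cancel h3)).symm
end
end

section
/- Let e ∈ L be a norm-lift and let A be a finite rank-1 ℤ_p[G]-module with invariants r ≥ 1, s ≥ 1 and t ∈ {0,…,p−1} (so p^s·a = e^s·(g−1)^(s(p−1))·a + t·(g−1)^r·a for every generator a of A). Then A is cohomologically trivial over G — that is, A^G = N·A and {x ∈ A : N·x = 0} = (g−1)A — if and only if t ≠ 0. -/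
noncomputable section

lemma NT (p : ℕ) [Fact p.Prime] : NL p * (gL p - 1) = 0 := by
  rw [NL, geom_sum_mul, gL_pow_p, sub_self]

lemma decomp (p : ℕ) [Fact p.Prime] (x : L p) :
    ∃ (c : PadicInt p) (y : L p), x = algebraMap (PadicInt p) (L p) c + (gL p - 1) * y := by
  induction x using MonoidAlgebra.induction_on with
  | of m =>
    refine ⟨1, ∑ i ∈ Finset.range (Multiplicative.toAdd m).val, gL p ^ i, ?_⟩
    rw [mul_geom_sum, map_one, add_sub_cancel, gL, ← map_pow, ← ofAdd_nsmul]
    haveI : NeZero p := ⟨(Fact.out : p.Prime).ne_zero⟩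
    congr 1
    simp
  | add x y hx hy =>
    obtain ⟨c, u, rfl⟩ := hx
    obtain ⟨d, v, rfl⟩ := hy
    exact ⟨c + d, u + v, by rw [map_add]; ring⟩
  | smul r x hx =>
    obtain ⟨c, u, rfl⟩ := hx
    refine ⟨r * c, algebraMap _ _ r * u, ?_⟩
    rw [Algebra.smul_def, map_mul]; ring

lemma decompZ (p : ℕ) [Fact p.Prime] (c : PadicInt p) (k : ℕ) :
    ∃ n : ℕ, n < p ^ k ∧ ∃ z : L p, algebraMap (PadicInt p) (L p) c = (n : L p) + (p : L p) ^ k * z := by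
  refine ⟨c.appr k, c.appr_lt k, ?_⟩
  have h := PadicInt.appr_spec k c
  obtain ⟨d, hd⟩ := Ideal.mem_span_singleton'.1 h
  refine ⟨algebraMap _ _ d, ?_⟩
  have : c = (c.appr k : PadicInt p) + (p : PadicInt p) ^ k * d := by rw [mul_comm, hd]; ring
  conv_lhs => rw [this]
  simp only [map_add, map_mul, map_pow, map_natCast]

lemma normLift_eq (p : ℕ) [Fact p.Prime] (e : L p) (he : IsNormLift p e) :
    (p : L p) = e * (gL p - 1) ^ (p - 1) + NL p := by
  obtain ⟨α, h⟩ := he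
  have hp := (Fact.out : p.Prime)
  let aug : L p →ₐ[PadicInt p] PadicInt p :=
    MonoidAlgebra.lift (PadicInt p) (PadicInt p) (Multiplicative (ZMod p)) 1
  have hg : aug (gL p) = 1 := by simp [aug, gL]
  have h2 := congrArg aug h
  simp only [map_add, map_mul, map_pow, map_sub, map_natCast, hg, map_one, map_smul, sub_self,
    NL, map_sum] at h2
  have : p - 1 ≠ 0 := by have := hp.two_le; omega
  simp [this] at h2
  have hα : α = 1 := by
    have hp0 : (p : PadicInt p) ≠ 0 := by exact_mod_cast hp.ne_zero
    exact (mul_right_cancel₀ hp0 (by rw [one_mul]; exact h2)).symm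
  rwa [hα, one_smul] at h

lemma pow_eq (p : ℕ) [Fact p.Prime] (e : L p) (he : IsNormLift p e) (s : ℕ) :
    (p : L p) ^ (s + 1) = e ^ (s + 1) * (gL p - 1) ^ ((s + 1) * (p - 1)) + (p : L p) ^ s * NL p := by
  have hp := (Fact.out : p.Prime)
  have h := normLift_eq p e he
  have hu : NL p * (e * (gL p - 1) ^ (p - 1)) = 0 := by
    obtain ⟨m, hm⟩ : ∃ m, p - 1 = m + 1 := ⟨p - 2, by have := hp.two_le; omega⟩
    rw [hm, pow_succ]
    linear_combination e * (gL p - 1) ^ m * NT p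
  have key : ∀ s : ℕ, (p : L p) ^ (s + 1) = (e * (gL p - 1) ^ (p - 1)) ^ (s + 1) + (p : L p) ^ s * NL p := by
    intro s
    generalize e * (gL p - 1) ^ (p - 1) = u at h hu
    generalize (p : L p) = q at h
    induction s with
    | zero => simpa using h
    | succ s ih =>
      have : q ^ (s + 1 + 1) = q * u ^ (s+1) + q ^ (s+1) * NL p := by
        linear_combination q * ih
      rw [this]
      linear_combination u ^ (s+1) * h + u ^ s * hu
  rw [key s, mul_pow, ← pow_mul, mul_comm (p - 1)]

lemma step (p : ℕ) [Fact p.Prime] (e : L p) (he : IsNormLift p e)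
    (A : Type) [AddCommGroup A] [Module (L p) A] [Finite A] (a : A)
    (ha : Submodule.span (L p) {a} = ⊤) (k : ℕ) :
    Nat.card (LinearMap.range (LinearMap.lsmul (L p) A ((gL p - 1) ^ (k + 1)))) ≤
     p * Nat.card (LinearMap.range (LinearMap.lsmul (L p) A ((gL p - 1) ^ (k + 1 + 1)))) := by
  have hp := (Fact.out : p.Prime)
  set B := LinearMap.range (LinearMap.lsmul (L p) A ((gL p - 1) ^ (k + 1))) with hB
  set C := LinearMap.range (LinearMap.lsmul (L p) A ((gL p - 1) ^ (k + 1 + 1))) with hC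
  have hCB : C ≤ B := by
    rintro _ ⟨x, rfl⟩
    exact ⟨(gL p - 1) • x, by
      simp only [LinearMap.lsmul_apply, smul_smul, ← pow_succ]⟩
  let f : Fin p × C → B := fun q =>
    ⟨(q.1 : ℕ) • ((gL p - 1) ^ (k + 1) • a) + q.2,
      B.add_mem (nsmul_mem (show _ ∈ B from ⟨a, rfl⟩) _) (hCB q.2.2)⟩
  have hf : Function.Surjective f := by
    rintro ⟨_, x, rfl⟩
    obtain ⟨l, rfl⟩ := Submodule.mem_span_singleton.1 (ha ▸ Submodule.mem_top : x ∈ Submodule.span (L p) {a})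
    obtain ⟨c, y, hl⟩ := decomp p l
    obtain ⟨n, hn, z, hc⟩ := decompZ p c 1
    rw [pow_one] at hn hc
    obtain ⟨m, hm⟩ : ∃ m, p - 1 = m + 1 := ⟨p - 2, by have := hp.two_le; omega⟩
    have h := normLift_eq p e he
    rw [hm] at h
    refine ⟨⟨⟨n, hn⟩, ⟨(gL p - 1) ^ (k + 1 + 1) • ((y + e * (gL p - 1) ^ m * z) • a), ⟨_, rfl⟩⟩⟩, ?_⟩
    apply Subtype.ext
    simp only [f, LinearMap.lsmul_apply]
    rw [← Nat.cast_smul_eq_nsmul (L p), smul_smul, smul_smul, smul_smul, ← add_smul]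
    congr 1
    rw [hl, hc]
    have h0 := NT p
    generalize (p : L p) = q at h
    rw [h]
    linear_combination (- (gL p - 1) ^ k * z) * h0
  have := Nat.card_le_card_of_surjective f hf
  simpa [Nat.card_prod] using this

lemma Tr_ne (p : ℕ) [Fact p.Prime] (e : L p) (he : IsNormLift p e)
    (A : Type) [AddCommGroup A] [Module (L p) A] [Finite A] (a : A)
    (ha : Submodule.span (L p) {a} = ⊤) (r : ℕ)
    (hcard_r : Nat.card (commSub p A) = p ^ (r + 1)) : (gL p - 1) ^ (r + 1) • a ≠ 0 := by
  have hp := (Fact.out : p.Prime)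
  have key : ∀ j : ℕ, p ^ (r + 1) ≤ p ^ j *
      Nat.card (LinearMap.range (LinearMap.lsmul (L p) A ((gL p - 1) ^ (j + 1)))) := by
    intro j
    induction j with
    | zero => rw [← hcard_r]; simp [commSub]
    | succ j ih =>
      refine ih.trans ?_
      rw [pow_succ p j, mul_assoc]
      exact Nat.mul_le_mul_left _ (step p e he A a ha j)
  intro h0
  have hbot : LinearMap.range (LinearMap.lsmul (L p) A ((gL p - 1) ^ (r + 1))) = ⊥ := by
    rw [eq_bot_iff]
    rintro _ ⟨x, rfl⟩
    obtain ⟨l, rfl⟩ := Submodule.mem_span_singleton.1 (ha ▸ Submodule.mem_top : x ∈ Submodule.span (L p) {a})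
    simp [h0]
  have := key r
  rw [hbot] at this
  simp at this
  exact absurd this (not_le.2 (Nat.pow_lt_pow_right hp.one_lt (Nat.lt_succ_self r)))

lemma card_ker_range (p : ℕ) [Fact p.Prime] (A : Type) [AddCommGroup A] [Module (L p) A]
    (f : A →ₗ[L p] A) :
    Nat.card A = Nat.card (LinearMap.ker f) * Nat.card (LinearMap.range f) := by
  rw [Submodule.card_eq_card_quotient_mul_card (LinearMap.ker f),
    Nat.card_congr f.quotKerEquivRange.toEquiv, mul_comm]

lemma sub_eq_of_card (p : ℕ) [Fact p.Prime] (A : Type) [AddCommGroup A] [Module (L p) A] [Finite A]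
    (B C : Submodule (L p) A) (h : B ≤ C) (hc : Nat.card C ≤ Nat.card B) : B = C := by
  apply SetLike.coe_injective
  exact Set.eq_of_subset_of_ncard_le h (by simpa [← Nat.card_coe_set_eq] using hc)

/-- a finite rank-1 `ℤ_p[G]`-module `A` with invariants `r, s ≥ 1` and
`t ∈ {0,…,p−1}` (w.r.t. a norm-lift `e`) is cohomologically trivial over `G` — i.e.
`A^G = N·A` and `{x : N·x = 0} = (g−1)A` — if and only if `t ≠ 0`. -/
theorem stmt_9 (p : ℕ) [Fact p.Prime] (e : L p) (he : IsNormLift p e)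
    (A : Type) [AddCommGroup A] [Module (L p) A] [Finite A]
    (hA : IsRankOne p A) (r s : ℕ) (hr : 1 ≤ r) (hs : 1 ≤ s)
    (hcard_r : Nat.card (commSub p A) = p ^ r)
    (hcard_s : Nat.card (fixedSub p A) = p ^ s)
    (t : ℕ) (htp : t < p)
    (ht : ∀ a : A, Submodule.span (L p) {a} = ⊤ →
      (p : L p) ^ s • a
        = (e ^ s * (gL p - 1) ^ (s * (p - 1))) • a + ((t : L p) * (gL p - 1) ^ r) • a) :
    (fixedSub p A = LinearMap.range (LinearMap.lsmul (L p) A (NL p)) ∧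
        LinearMap.ker (LinearMap.lsmul (L p) A (NL p)) = commSub p A)
      ↔ t ≠ 0 := by
  have hp := (Fact.out : p.Prime)
  obtain ⟨-, a, ha⟩ := hA
  obtain ⟨r, rfl⟩ : ∃ r', r = r' + 1 := ⟨r - 1, by omega⟩
  obtain ⟨s, rfl⟩ : ∃ s', s = s' + 1 := ⟨s - 1, by omega⟩
  have hT := Tr_ne p e he A a ha r hcard_r
  have h1 := ht a ha
  rw [pow_eq p e he s, add_smul, add_right_inj] at h1
  have hcardA : Nat.card A = p ^ (s + 1) * p ^ (r + 1) := by
    rw [card_ker_range p A (LinearMap.lsmul (L p) A (gL p - 1)), ← hcard_r, ← hcard_s]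
    rfl
  have hTN : commSub p A ≤ LinearMap.ker (LinearMap.lsmul (L p) A (NL p)) := by
    rintro _ ⟨x, rfl⟩
    rw [LinearMap.mem_ker, LinearMap.lsmul_apply, LinearMap.lsmul_apply, smul_smul, NT, zero_smul]
  have hNT : LinearMap.range (LinearMap.lsmul (L p) A (NL p)) ≤ fixedSub p A := by
    rintro _ ⟨x, rfl⟩
    simp only [fixedSub, LinearMap.mem_ker, LinearMap.lsmul_apply, smul_smul]
    rw [mul_comm, NT, zero_smul]
  constructor
  · rintro ⟨h2, -⟩ rfl
    rw [Nat.cast_zero, zero_mul, zero_smul] at h1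
    rw [h2] at hcard_s
    let f : Fin (p ^ s) → LinearMap.range (LinearMap.lsmul (L p) A (NL p)) := fun q =>
      ⟨NL p • ((q : ℕ) : L p) • a, ⟨_, rfl⟩⟩
    have hf : Function.Surjective f := by
      rintro ⟨_, x, rfl⟩
      obtain ⟨l, rfl⟩ := Submodule.mem_span_singleton.1
        (ha ▸ Submodule.mem_top : x ∈ Submodule.span (L p) {a})
      obtain ⟨c, y, hl⟩ := decomp p l
      obtain ⟨n, hn, z, hc⟩ := decompZ p c s
      refine ⟨⟨n, hn⟩, Subtype.ext ?_⟩
      simp only [f, LinearMap.lsmul_apply]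
      have : NL p * l = NL p * n + z * ((p : L p) ^ s * NL p) := by
        rw [hl, hc]
        linear_combination y * NT p
      rw [smul_smul, smul_smul, this, add_smul, mul_smul z, h1, smul_zero, add_zero]
    have := Nat.card_le_card_of_surjective f hf
    rw [hcard_s, Nat.card_fin] at this
    exact absurd this (not_le.2 (Nat.pow_lt_pow_right hp.one_lt (Nat.lt_succ_self s)))
  · intro ht0
    have hne : ((p : L p) ^ s * NL p) • a ≠ 0 := by
      rw [h1]
      intro h0
      rw [mul_smul, Nat.cast_smul_eq_nsmul] at h0
      have d1 := addOrderOf_dvd_of_nsmul_eq_zero h0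
      have d2 := addOrderOf_dvd_natCard ((gL p - 1) ^ (r + 1) • a)
      rw [hcardA, ← pow_add] at d2
      have hcop : Nat.Coprime t (p ^ (s + 1 + (r + 1))) :=
        (Nat.Coprime.pow_right _ (Nat.coprime_of_lt_prime ht0 htp hp).symm)
      have := Nat.eq_one_of_dvd_coprimes hcop d1 d2
      exact hT (AddMonoid.addOrderOf_eq_one_iff.1 this)
    have hle : p ^ (s + 1) ≤ Nat.card (LinearMap.range (LinearMap.lsmul (L p) A (NL p))) := by
      have hd : Nat.card (LinearMap.range (LinearMap.lsmul (L p) A (NL p))) ∣ p ^ (s + 1) := by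
        rw [← hcard_s]
        exact AddSubgroup.card_dvd_of_le (H := (LinearMap.range (LinearMap.lsmul (L p) A (NL p))).toAddSubgroup)
          (K := (fixedSub p A).toAddSubgroup) hNT
      obtain ⟨j, hj, hj2⟩ := (Nat.dvd_prime_pow hp).1 hd
      rw [hj2]
      by_contra hcon
      have hjs : j ≤ s := by
        by_contra h
        exact hcon (Nat.pow_le_pow_right hp.pos (by omega))
      apply hne
      have d2 : addOrderOf (NL p • a) ∣ p ^ j := by
        rw [← hj2]
        exact AddSubgroup.addOrderOf_dvd_natCard
          (Submodule.toAddSubgroup (LinearMap.range (LinearMap.lsmul (L p) A (NL p)))) ⟨a, rfl⟩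
      have := addOrderOf_dvd_iff_nsmul_eq_zero.1 (d2.trans (pow_dvd_pow p hjs))
      rw [mul_smul, ← Nat.cast_pow, Nat.cast_smul_eq_nsmul, this]
    have hEq := sub_eq_of_card p A _ _ hNT (by rw [hcard_s]; exact hle)
    refine ⟨hEq.symm, (sub_eq_of_card p A _ _ hTN ?_).symm⟩
    have h3 := card_ker_range p A (LinearMap.lsmul (L p) A (NL p))
    rw [hEq, hcard_s, hcardA, mul_comm] at h3
    rw [hcard_r, Nat.eq_of_mul_eq_mul_right (pow_pos hp.pos _) h3]
end
end
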